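/- Let g : V → V be smooth with g*θ⁰ = θ⁰, where θ⁰_z(v) = (1/2)Ω(z, v). Then the derivative of g at z applied to z equals g(z), i.e., Dg_z(z) = g(z) for every z ∈ V. -/

import Mathlib

/-- if g is smooth and pulls back θ⁰ to θ⁰, i.e.
Ω(g(z), Dg_z(v)) = Ω(z, v) for all z, v, then Dg_z(z) = g(z) for all z. -/
theorem stmt4 {V : Type*} [NormedAddCommGroup V] [NormedSpace ℝ V]
    [FiniteDimensional ℝ V]
    (Ω : V →L[ℝ] V →L[ℝ] ℝ)
    (halt : ∀ x, Ω x x = 0)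
    (hnd : ∀ x, (∀ y, Ω x y = 0) → x = 0)
    (g : V → V) (hg : ContDiff ℝ (⊤ : ℕ∞) g)
    (hpull : ∀ z v : V, Ω (g z) (fderiv ℝ g z v) = Ω z v) :
    ∀ z : V, fderiv ℝ g z z = g z := by
  have hanti : ∀ x y, Ω x y = - Ω y x := by
    intro x y
    have h := halt (x + y)
    simp only [map_add, ContinuousLinearMap.add_apply, halt] at h
    linarith
  have hg1 : Differentiable ℝ g := hg.differentiable (by simp)
  have hg2 : Differentiable ℝ (fderiv ℝ g) :=
    (hg.fderiv_right (m := 1) (by norm_cast)).differentiable (by simp)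
  intro z
  have hsymm : ∀ v w, fderiv ℝ (fderiv ℝ g) z v w = fderiv ℝ (fderiv ℝ g) z w v := by
    intro v w
    exact second_derivative_symmetric (f := g) (fun y => (hg1 y).hasFDerivAt)
      (hg2 z).hasFDerivAt v w
  have hder : ∀ w v, Ω (fderiv ℝ g z w) (fderiv ℝ g z v)
      + Ω (g z) (fderiv ℝ (fderiv ℝ g) z w v) = Ω w v := by
    intro w v
    have h1 : HasFDerivAt (fun y => Ω (g y)) (Ω.comp (fderiv ℝ g z)) z :=
      Ω.hasFDerivAt.comp z (hg1 z).hasFDerivAt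
    have h2 : HasFDerivAt (fun y => fderiv ℝ g y v)
        ((fderiv ℝ (fderiv ℝ g) z).flip v) z := by
      simpa using (hg2 z).hasFDerivAt.clm_apply (hasFDerivAt_const v z)
    have h3 := h1.clm_apply h2
    have h4 : HasFDerivAt (fun y => Ω y v) (Ω.flip v) z := (Ω.flip v).hasFDerivAt
    have h5 : (fun y => Ω (g y) (fderiv ℝ g y v)) = fun y => Ω y v := funext fun y => hpull y v
    rw [h5] at h3
    have h6 := congrArg (fun L : V →L[ℝ] ℝ => L w) (h3.unique h4)
    simp at h6
    linarith
  have hsp : ∀ w v, Ω (fderiv ℝ g z w) (fderiv ℝ g z v) = Ω w v := by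
    intro w v
    have h1 := hder w v
    have h2 := hder v w
    rw [hsymm v w, hanti (fderiv ℝ g z v), hanti v w] at h2
    linarith
  have hinj : Function.Injective (fderiv ℝ g z : V →ₗ[ℝ] V) := by
    rw [injective_iff_map_eq_zero]
    intro x hx
    refine hnd x fun y => ?_
    have hx' : fderiv ℝ g z x = 0 := hx
    rw [← hsp, hx']
    simp
  have hsurj := LinearMap.injective_iff_surjective.1 hinj
  rw [← sub_eq_zero]
  refine hnd _ fun y => ?_
  obtain ⟨v, rfl⟩ := hsurj y
  have h1 := hsp z v
  have h2 := hpull z v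
  simp only [map_sub, ContinuousLinearMap.sub_apply, ContinuousLinearMap.coe_coe]
  linarith
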